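/- arXiv:2508.06031 — 4 statements merged into one kernel-verified Lean document; each statement's English description precedes it below -/
import Mathlib

section
/- Let θ > 0, S > 0, p > 0 and l̄ > 0, and set l* = √(θ·S/p) − S. If 0 ≤ l* ≤ l̄, then l* is the unique maximizer of f(l) = θ·l/(l + S) − p·l on the interval [0, l̄]: f(l) ≤ f(l*) for every l ∈ [0, l̄], with equality only at l = l*. -/
/-- If `p * (a + S) ^ 2 = θ * S`, the utility loss at `l` relative to `a` is an explicit square. -/
theorem erc_utility_sub_eq {θ S p a l : ℝ} (hS : S ≠ 0) (hl : l + S ≠ 0)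
    (h : p * (a + S) ^ 2 = θ * S) :
    (θ * a / (a + S) - p * a) - (θ * l / (l + S) - p * l) = p * (l - a) ^ 2 / (l + S) := by
  obtain rfl : θ = p * (a + S) ^ 2 / S := by rw [h, mul_div_cancel_right₀ _ hS]
  field_simp
  ring

/-- Let θ > 0, S > 0, p > 0 and l̄ > 0, and set l* = √(θ·S/p) − S.
If 0 ≤ l* ≤ l̄, then l* is the unique maximizer of f(l) = θ·l/(l + S) − p·l
on [0, l̄]: f(l) ≤ f(l*) for every l ∈ [0, l̄], with equality only at l = l*. -/
theorem erc_interior_best_response_unique_max (θ S p lbar : ℝ)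
    (hθ : 0 < θ) (hS : 0 < S) (hp : 0 < p) (hlbar : 0 < lbar)
    (lstar : ℝ) (hstar : lstar = Real.sqrt (θ * S / p) - S)
    (h0 : 0 ≤ lstar) (h1 : lstar ≤ lbar) :
    ∀ l ∈ Set.Icc (0 : ℝ) lbar,
      (θ * l / (l + S) - p * l ≤ θ * lstar / (lstar + S) - p * lstar) ∧
      (θ * l / (l + S) - p * l = θ * lstar / (lstar + S) - p * lstar → l = lstar) := by
  rintro l ⟨hl, -⟩
  have hlS : 0 < l + S := by linarith
  have hsq : p * (lstar + S) ^ 2 = θ * S := by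
    rw [hstar, sub_add_cancel, Real.sq_sqrt (by positivity), mul_div_cancel₀ _ hp.ne']
  have key := erc_utility_sub_eq hS.ne' hlS.ne' hsq
  refine ⟨sub_nonneg.mp (key ▸ by positivity), fun heq => ?_⟩
  rw [heq, sub_self, eq_comm, div_eq_zero_iff] at key
  simpa [hp.ne', hlS.ne', sub_eq_zero] using key
end

section
/- Let M ≥ 2 be a natural number, p > 0, and θ_1, ..., θ_M > 0. Suppose real numbers l_1, ..., l_M satisfy l_m = ψ − p·ψ²/θ_m for every m, where ψ := Σ_{j=1}^M l_j, and suppose ψ > 0. Then ψ = (M − 1)/(p·Σ_{j=1}^M (1/θ_j)). -/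
/-- Let M ≥ 2, p > 0, and θ_1, …, θ_M > 0. Suppose real numbers l_1, …, l_M
satisfy l_m = ψ − p·ψ²/θ_m for every m, where ψ = Σ_j l_j, and ψ > 0. Then
ψ = (M − 1)/(p·Σ_j 1/θ_j). -/
theorem erc_interior_total_nonce (M : ℕ) (hM : 2 ≤ M) (p : ℝ) (hp : 0 < p)
    (θ : Fin M → ℝ) (hθ : ∀ m, 0 < θ m)
    (l : Fin M → ℝ) (ψ : ℝ) (hψdef : ψ = ∑ j, l j) (hψpos : 0 < ψ)
    (h : ∀ m, l m = ψ - p * ψ ^ 2 / θ m) :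
    ψ = ((M : ℝ) - 1) / (p * ∑ j, 1 / θ j) := by
  have hsum : 0 < ∑ j, 1 / θ j :=
    Finset.sum_pos (fun j _ => one_div_pos.mpr (hθ j)) ⟨⟨0, by lia⟩, Finset.mem_univ _⟩
  have key : ψ = M * ψ - p * ψ ^ 2 * ∑ j, 1 / θ j := by
    calc ψ = ∑ j, (ψ - p * ψ ^ 2 * (1 / θ j)) := by
          exact hψdef.trans (Finset.sum_congr rfl fun j _ => by rw [h j, mul_one_div])
      _ = M * ψ - p * ψ ^ 2 * ∑ j, 1 / θ j := by
          rw [Finset.sum_sub_distrib, ← Finset.mul_sum]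
          simp
  rw [eq_div_iff (mul_pos hp hsum).ne']
  apply mul_left_cancel₀ hψpos.ne'
  linear_combination key
end

section
/- Let M ≥ 2 be a natural number, p > 0, and θ_1, ..., θ_M > 0. Define Θ := Σ_{j=1}^M (1/θ_j), ψ := (M − 1)/(p·Θ), and l_m⁺ := ψ·(1 − (M − 1)/(θ_m·Θ)). Then for every m, writing S_m := Σ_{j≠m} l_j⁺, the best-response equation l_m⁺ = √(θ_m·S_m/p) − S_m holds. -/
/-- Let M ≥ 2, p > 0, and θ_1, …, θ_M > 0. Define Θ = Σ_j 1/θ_j,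
ψ = (M − 1)/(p·Θ), and l_m⁺ = ψ·(1 − (M − 1)/(θ_m·Θ)). Then for every m,
writing S_m = Σ_{j≠m} l_j⁺, the best-response equation
l_m⁺ = √(θ_m·S_m/p) − S_m holds. -/
theorem erc_closed_form_best_response (M : ℕ) (hM : 2 ≤ M) (p : ℝ) (hp : 0 < p)
    (θ : Fin M → ℝ) (hθ : ∀ m, 0 < θ m)
    (Θ ψ : ℝ) (lplus : Fin M → ℝ)
    (hΘ : Θ = ∑ j, 1 / θ j)
    (hψ : ψ = ((M : ℝ) - 1) / (p * Θ))
    (hl : ∀ m, lplus m = ψ * (1 - ((M : ℝ) - 1) / (θ m * Θ))) :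
    ∀ m, lplus m =
      Real.sqrt (θ m * (∑ j ∈ Finset.univ.erase m, lplus j) / p)
        - ∑ j ∈ Finset.univ.erase m, lplus j := by
  have hM1 : (0 : ℝ) < (M : ℝ) - 1 := by
    have : (2 : ℝ) ≤ M := by exact_mod_cast hM
    linarith
  have hΘpos : 0 < Θ := by
    rw [hΘ]
    exact Finset.sum_pos (fun j _ => one_div_pos.mpr (hθ j)) ⟨⟨0, by omega⟩, Finset.mem_univ _⟩
  have hψpos : 0 < ψ := by
    rw [hψ]
    positivity
  have hpψ : ((M : ℝ) - 1) / Θ = p * ψ := by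
    rw [hψ]
    field_simp
  have hterm : ∀ j, lplus j = ψ - ψ * (((M : ℝ) - 1) / Θ) * (1 / θ j) := by
    intro j
    have := (hθ j).ne'
    rw [hl]
    field_simp
  have hsum : ∑ j, lplus j = ψ := by
    simp only [hterm, Finset.sum_sub_distrib, ← Finset.mul_sum, ← hΘ]
    simp only [Finset.sum_const, Finset.card_univ, Fintype.card_fin, nsmul_eq_mul]
    field_simp
    ring
  intro m
  have hm := (hθ m).ne'
  have hS : ∑ j ∈ Finset.univ.erase m, lplus j = ψ - lplus m := by
    rw [Finset.sum_erase_eq_sub (Finset.mem_univ m), hsum]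
  have hsq : θ m * (ψ - lplus m) / p = ψ ^ 2 := by
    rw [hterm, hpψ]
    field_simp
    ring
  rw [hS, hsq, Real.sqrt_sq hψpos.le]
  ring
end

section
/- Let M ≥ 2 be a natural number, p > 0, θ_1, ..., θ_M > 0, and l̄_1, ..., l̄_M > 0. Define Θ := Σ_{j=1}^M (1/θ_j), ψ := (M − 1)/(p·Θ), and l_m⁺ := ψ·(1 − (M − 1)/(θ_m·Θ)). Assume 0 ≤ l_m⁺ ≤ l̄_m for every m. Then the profile (l_1⁺, ..., l_M⁺) is a Nash equilibrium of the continuous-relaxed ERC game: for every m and every l ∈ [0, l̄_m], θ_m·l/(l + Σ_{j≠m} l_j⁺) − p·l ≤ θ_m·l_m⁺/(l_m⁺ + Σ_{j≠m} l_j⁺) − p·l_m⁺. -/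
/-- If the opponents' total `S` and the total `T` satisfy the first-order condition
`θ * S = p * T ^ 2`, then `T - S` maximizes `l ↦ θ * l / (l + S) - p * l` on `[0, ∞)`. -/
theorem contest_payoff_le {θ p S T l : ℝ} (hp : 0 ≤ p) (hS : 0 < S) (hT : 0 < T)
    (h : θ * S = p * T ^ 2) (hl : 0 ≤ l) :
    θ * l / (l + S) - p * l ≤ θ * (T - S) / T - p * (T - S) := by
  have ht : 0 < l + S := by positivity
  have key : θ * (T - S) / T - p * (T - S) - (θ * l / (l + S) - p * l)
      = p * (l + S - T) ^ 2 / (l + S) := by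
    field_simp
    linear_combination (T - l - S) * h
  have : 0 ≤ p * (l + S - T) ^ 2 / (l + S) := by positivity
  linarith

/-- Let M ≥ 2, p > 0, θ_m > 0 and l̄_m > 0 for each m. Define Θ = Σ_j 1/θ_j,
ψ = (M − 1)/(p·Θ), and l_m⁺ = ψ·(1 − (M − 1)/(θ_m·Θ)). If 0 ≤ l_m⁺ ≤ l̄_m for
every m, then (l_1⁺, …, l_M⁺) is a Nash equilibrium of the continuous-relaxed
ERC game: for every m and every l ∈ [0, l̄_m],
θ_m·l/(l + Σ_{j≠m} l_j⁺) − p·l ≤ θ_m·l_m⁺/(l_m⁺ + Σ_{j≠m} l_j⁺) − p·l_m⁺. -/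
theorem erc_closed_form_is_nash (M : ℕ) (hM : 2 ≤ M) (p : ℝ) (hp : 0 < p)
    (θ : Fin M → ℝ) (hθ : ∀ m, 0 < θ m)
    (lbar : Fin M → ℝ) (hlbar : ∀ m, 0 < lbar m)
    (Θ ψ : ℝ) (lplus : Fin M → ℝ)
    (hΘ : Θ = ∑ j, 1 / θ j)
    (hψ : ψ = ((M : ℝ) - 1) / (p * Θ))
    (hl : ∀ m, lplus m = ψ * (1 - ((M : ℝ) - 1) / (θ m * Θ)))
    (hfeas : ∀ m, 0 ≤ lplus m ∧ lplus m ≤ lbar m) :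
    ∀ m, ∀ l ∈ Set.Icc (0 : ℝ) (lbar m),
      θ m * l / (l + ∑ j ∈ Finset.univ.erase m, lplus j) - p * l ≤
        θ m * lplus m / (lplus m + ∑ j ∈ Finset.univ.erase m, lplus j)
          - p * lplus m := by
  have hM1 : (0 : ℝ) < (M : ℝ) - 1 := by
    have : (2 : ℝ) ≤ M := by exact_mod_cast hM
    linarith
  have hΘpos : 0 < Θ := by
    rw [hΘ]
    exact Finset.sum_pos (fun j _ => one_div_pos.mpr (hθ j)) ⟨⟨0, by omega⟩, Finset.mem_univ _⟩
  have hψpos : 0 < ψ := by rw [hψ]; positivity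
  have hsum : ∑ j, lplus j = ψ := by
    have hterm : ∀ j, lplus j = ψ - ψ * ((M : ℝ) - 1) / Θ * (1 / θ j) := by
      intro j
      have := hθ j
      rw [hl j]
      field_simp
    simp_rw [hterm]
    rw [Finset.sum_sub_distrib, ← Finset.mul_sum, ← hΘ]
    simp only [Finset.sum_const, Finset.card_univ, Fintype.card_fin, nsmul_eq_mul]
    field_simp
    ring
  intro m l hlm
  have hθm := hθ m
  have htotal : lplus m + ∑ j ∈ Finset.univ.erase m, lplus j = ψ := by
    rw [Finset.add_sum_erase _ _ (Finset.mem_univ m), hsum]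
  have hS : ∑ j ∈ Finset.univ.erase m, lplus j = ψ * (((M : ℝ) - 1) / (θ m * Θ)) := by
    linear_combination htotal - hl m
  have hSpos : 0 < ∑ j ∈ Finset.univ.erase m, lplus j := by rw [hS]; positivity
  have hfoc : θ m * ∑ j ∈ Finset.univ.erase m, lplus j = p * ψ ^ 2 := by
    rw [hS, hψ]
    field_simp
  rw [htotal, eq_sub_of_add_eq htotal]
  exact contest_payoff_le hp.le hSpos hψpos hfoc hlm.1
end
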